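/- Let N ≥ 2, let m ≥ 2, let P : ℝ^N → ℝ be a homogeneous polynomial of degree m, and let 1 ≤ i ≤ N. Then ∫_{∂B₁(0)} P(x) x_i dσ(x) = (1/(2(N+2) + (N+m+1)(m−3))) ∫_{∂B₁(0)} (ΔP)(x) x_i dσ(x), where Δ is the Euclidean Laplacian. -/

import Mathlib

open MeasureTheory

/-- The Euclidean Laplacian: sum of second partial derivatives. -/
noncomputable def lap {N : ℕ} (u : EuclideanSpace ℝ (Fin N) → ℝ)
    (x : EuclideanSpace ℝ (Fin N)) : ℝ :=
  ∑ i : Fin N,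
    fderiv ℝ (fun z => fderiv ℝ u z (EuclideanSpace.single i 1)) x (EuclideanSpace.single i 1)

/-- The surface measure on the unit sphere of `ℝ^N`. -/
noncomputable def sphereMeasure (N : ℕ) :
    Measure (Metric.sphere (0 : EuclideanSpace ℝ (Fin N)) 1) :=
  (volume : Measure (EuclideanSpace ℝ (Fin N))).toSphere

namespace MvPolynomial

lemma IsHomogeneous.eval_mul {σ R : Type*} [Fintype σ] [CommSemiring R] {p : MvPolynomial σ R}
    {d : ℕ} (hp : p.IsHomogeneous d) (r : R) (x : σ → R) :
    eval (fun j => r * x j) p = r ^ d * eval x p := by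
  rw [eval_eq', eval_eq', Finset.mul_sum]
  refine Finset.sum_congr rfl fun k hk => ?_
  have hd : ∑ j, k j = d := by
    rw [← Finsupp.degree_eq_sum, Finsupp.degree_eq_weight_one]
    exact hp (mem_support_iff.1 hk)
  simp_rw [mul_pow, Finset.prod_mul_distrib, Finset.prod_pow_eq_pow_sum, hd]
  ring

lemma hasFDerivAt_eval_euclidean {ι : Type*} [Fintype ι] (p : MvPolynomial ι ℝ)
    (x : EuclideanSpace ℝ ι) :
    HasFDerivAt (fun z : EuclideanSpace ℝ ι => eval (fun k => z k) p)
      (∑ k, eval (fun l => x l) (pderiv k p) • (EuclideanSpace.proj k : EuclideanSpace ℝ ι →L[ℝ] ℝ)) x := by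
  classical
  induction p using MvPolynomial.induction_on with
  | C a => simpa using hasFDerivAt_const a x
  | add p q hp hq =>
    simp only [map_add, add_smul, Finset.sum_add_distrib]
    exact hp.add hq
  | mul_X p j hp =>
    simp only [map_mul, eval_X]
    have hX : HasFDerivAt (fun z : EuclideanSpace ℝ ι => z j)
        (EuclideanSpace.proj j : EuclideanSpace ℝ ι →L[ℝ] ℝ) x :=
      (EuclideanSpace.proj j : EuclideanSpace ℝ ι →L[ℝ] ℝ).hasFDerivAt
    refine (hp.mul hX).congr_fderiv ?_
    simp only [Derivation.leibniz, pderiv_X, smul_eq_mul, map_add, map_mul, eval_X, add_smul,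
      Finset.sum_add_distrib, Finset.smul_sum, smul_smul]
    congr 1
    simp [Pi.single_apply, apply_ite]

lemma fderiv_eval_single {ι : Type*} [Fintype ι] [DecidableEq ι] (p : MvPolynomial ι ℝ)
    (x : EuclideanSpace ℝ ι) (j : ι) :
    fderiv ℝ (fun z : EuclideanSpace ℝ ι => eval (fun k => z k) p) x (EuclideanSpace.single j 1) =
      eval (fun k => x k) (pderiv j p) := by
  simp [(hasFDerivAt_eval_euclidean p x).fderiv]

lemma lap_eval {N : ℕ} (p : MvPolynomial (Fin N) ℝ) (x : EuclideanSpace ℝ (Fin N)) :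
    lap (fun z => eval (fun k => z k) p) x =
      eval (fun k => x k) (∑ j, pderiv j (pderiv j p)) := by
  simp only [lap, fderiv_eval_single, map_sum]

end MvPolynomial

open MvPolynomial

lemma integrable_eval_mul_exp_neg_norm_sq {ι : Type*} [Fintype ι] (p : MvPolynomial ι ℝ) :
    Integrable fun x : EuclideanSpace ℝ ι => eval (fun k => x k) p * Real.exp (-‖x‖ ^ 2) := by
  induction p using MvPolynomial.induction_on' with
  | monomial k a =>
    have h1 (n : ℕ) : Integrable fun t : ℝ => t ^ n * Real.exp (-t ^ 2) := by
      have := integrable_rpow_mul_exp_neg_mul_sq one_pos (s := n)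
        (by linarith [n.cast_nonneg (α := ℝ)])
      simpa using this
    have h2 := (Integrable.fintype_prod (μ := fun _ : ι => (volume : Measure ℝ))
      fun j => h1 (k j)).const_mul a
    have h3 := (PiLp.volume_preserving_ofLp ι).integrable_comp_of_integrable h2
    refine h3.congr (.of_forall fun x => ?_)
    simp [eval_monomial, Finsupp.prod_fintype, EuclideanSpace.norm_sq_eq, Finset.prod_mul_distrib,
      ← Real.exp_sum, mul_assoc]
  | add p q hp hq =>
    simp only [map_add, add_mul]
    exact hp.add hq

/-- Gaussian integration by parts for polynomials. -/
lemma integral_eval_pderiv_mul_exp_neg_norm_sq {ι : Type*} [Fintype ι] (p : MvPolynomial ι ℝ)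
    (j : ι) :
    ∫ x : EuclideanSpace ℝ ι, eval (fun k => x k) (pderiv j p) * Real.exp (-‖x‖ ^ 2) =
      2 * ∫ x : EuclideanSpace ℝ ι, eval (fun k => x k) (X j * p) * Real.exp (-‖x‖ ^ 2) := by
  classical
  have hG (x : EuclideanSpace ℝ ι) : HasFDerivAt (fun z => Real.exp (-‖z‖ ^ 2))
      (Real.exp (-‖x‖ ^ 2) • (-(2 • innerSL ℝ x) : EuclideanSpace ℝ ι →L[ℝ] ℝ)) x :=
    HasFDerivAt.exp (f := fun z => -‖z‖ ^ 2) (hasStrictFDerivAt_norm_sq x).hasFDerivAt.neg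
  have hG' (x : EuclideanSpace ℝ ι) :
      fderiv ℝ (fun z => Real.exp (-‖z‖ ^ 2)) x (EuclideanSpace.single j 1) =
        -2 * (x j * Real.exp (-‖x‖ ^ 2)) := by
    rw [(hG x).fderiv]
    simp [EuclideanSpace.inner_single_right]
    ring
  have hX : (fun x : EuclideanSpace ℝ ι => eval (fun k => x k) p *
      fderiv ℝ (fun z => Real.exp (-‖z‖ ^ 2)) x (EuclideanSpace.single j 1)) =
      fun x => -2 * (eval (fun k => x k) (X j * p) * Real.exp (-‖x‖ ^ 2)) := by
    ext x
    rw [hG', map_mul, eval_X]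
    ring
  have key := integral_mul_fderiv_eq_neg_fderiv_mul_of_integrable (μ := volume)
    (f := fun x : EuclideanSpace ℝ ι => eval (fun k => x k) p)
    (g := fun x => Real.exp (-‖x‖ ^ 2)) (v := EuclideanSpace.single j 1)
    (by simpa only [fderiv_eval_single] using integrable_eval_mul_exp_neg_norm_sq (pderiv j p))
    (by rw [hX]; exact (integrable_eval_mul_exp_neg_norm_sq (X j * p)).const_mul _)
    (integrable_eval_mul_exp_neg_norm_sq p)
    (fun x _ => (hasFDerivAt_eval_euclidean p x).differentiableAt)
    (fun x _ => (hG x).differentiableAt)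
  rw [hX, integral_const_mul] at key
  simp only [fderiv_eval_single] at key
  linarith

lemma integral_volumeIoiPow_pow_mul_exp_neg_sq (n d : ℕ) :
    ∫ r : Set.Ioi (0 : ℝ), (r : ℝ) ^ d * Real.exp (-(r : ℝ) ^ 2) ∂(Measure.volumeIoiPow n) =
      1 / 2 * Real.Gamma (((d + n : ℕ) + 1) / 2) := by
  simp only [Measure.volumeIoiPow, ENNReal.ofReal]
  rw [integral_withDensity_eq_integral_smul (measurable_subtype_coe.pow_const _).real_toNNReal,
    integral_subtype_comap measurableSet_Ioi
      fun r : ℝ => Real.toNNReal (r ^ n) • (r ^ d * Real.exp (-r ^ 2)),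
    ← integral_rpow_mul_exp_neg_rpow two_pos
      (by linarith [(d + n).cast_nonneg (α := ℝ)] : (-1 : ℝ) < (d + n : ℕ))]
  refine setIntegral_congr_fun measurableSet_Ioi fun r hr => ?_
  have hr0 : (0 : ℝ) ≤ r ^ n := pow_nonneg (le_of_lt hr) n
  simp only [NNReal.smul_def, Real.coe_toNNReal _ hr0, smul_eq_mul, Real.rpow_natCast,
    Real.rpow_ofNat]
  ring

/-- Polar coordinates for the Gaussian integral of a homogeneous polynomial. -/
lemma integral_eval_mul_exp_neg_norm_sq {N d : ℕ} (hN : N ≠ 0) {p : MvPolynomial (Fin N) ℝ}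
    (hp : p.IsHomogeneous d) :
    ∫ x : EuclideanSpace ℝ (Fin N), eval (fun k => x k) p * Real.exp (-‖x‖ ^ 2) =
      (∫ x : Metric.sphere (0 : EuclideanSpace ℝ (Fin N)) 1,
        eval (fun k => (x : EuclideanSpace ℝ (Fin N)) k) p ∂(sphereMeasure N)) *
        (1 / 2 * Real.Gamma ((d + N) / 2)) := by
  have : NeZero N := ⟨hN⟩
  let F : EuclideanSpace ℝ (Fin N) → ℝ := fun x => eval (fun k => x k) p * Real.exp (-‖x‖ ^ 2)
  have hd : (((d + (N - 1) : ℕ) : ℝ) + 1) = d + N := by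
    norm_cast
    omega
  calc
    ∫ x, F x = ∫ x : ({(0)}ᶜ : Set (EuclideanSpace ℝ (Fin N))), F x
          ∂(volume.comap Subtype.val) := by
      rw [integral_subtype_comap (measurableSet_singleton _).compl F, restrict_compl_singleton]
    _ = ∫ z : Metric.sphere (0 : EuclideanSpace ℝ (Fin N)) 1 × Set.Ioi (0 : ℝ),
          F ((z.2 : ℝ) • (z.1 : EuclideanSpace ℝ (Fin N)))
          ∂(volume : Measure (EuclideanSpace ℝ (Fin N))).toSphere.prod
            (.volumeIoiPow (N - 1)) := by
      have h := Measure.measurePreserving_homeomorphUnitSphereProd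
        (volume : Measure (EuclideanSpace ℝ (Fin N)))
      rw [finrank_euclideanSpace_fin] at h
      rw [← h.integral_comp (Homeomorph.measurableEmbedding _)]
      refine integral_congr_ae (.of_forall fun x => ?_)
      have hx : ‖(x : EuclideanSpace ℝ (Fin N))‖ ≠ 0 := norm_ne_zero_iff.2 x.2
      simp [smul_smul, hx]
    _ = ∫ z : Metric.sphere (0 : EuclideanSpace ℝ (Fin N)) 1 × Set.Ioi (0 : ℝ),
          eval (fun k => (z.1 : EuclideanSpace ℝ (Fin N)) k) p *
            ((z.2 : ℝ) ^ d * Real.exp (-(z.2 : ℝ) ^ 2))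
          ∂(volume : Measure (EuclideanSpace ℝ (Fin N))).toSphere.prod
            (.volumeIoiPow (N - 1)) := by
      refine integral_congr_ae (.of_forall fun z => ?_)
      simp only [F, PiLp.smul_apply, smul_eq_mul, hp.eval_mul, norm_smul, norm_eq_of_mem_sphere,
        mul_one, Real.norm_eq_abs, sq_abs]
      ring
    _ = _ := by
      rw [integral_prod_mul
        (fun x : Metric.sphere (0 : EuclideanSpace ℝ (Fin N)) 1 =>
          eval (fun k => (x : EuclideanSpace ℝ (Fin N)) k) p)
        (fun r : Set.Ioi (0 : ℝ) => (r : ℝ) ^ d * Real.exp (-(r : ℝ) ^ 2)),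
        integral_volumeIoiPow_pow_mul_exp_neg_sq, hd, sphereMeasure]

lemma integral_eval_laplacian_mul_X_mul_exp_neg_norm_sq {ι : Type*} [Fintype ι] {m : ℕ}
    {p : MvPolynomial ι ℝ} (hp : p.IsHomogeneous m) (i : ι) :
    ∫ x : EuclideanSpace ℝ ι,
        eval (fun k => x k) ((∑ j, pderiv j (pderiv j p)) * X i) * Real.exp (-‖x‖ ^ 2) =
      2 * (m - 1) * ∫ x : EuclideanSpace ℝ ι,
        eval (fun k => x k) (p * X i) * Real.exp (-‖x‖ ^ 2) := by
  classical
  let E (q : MvPolynomial ι ℝ) : ℝ :=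
    ∫ x : EuclideanSpace ℝ ι, eval (fun k => x k) q * Real.exp (-‖x‖ ^ 2)
  have hadd (q r) : E (q + r) = E q + E r := by
    simp only [E, map_add, add_mul]
    exact integral_add (integrable_eval_mul_exp_neg_norm_sq q)
      (integrable_eval_mul_exp_neg_norm_sq r)
  have hsmul (c : ℝ) (q) : E (c • q) = c * E q := by
    simp only [E, smul_eval, mul_assoc, integral_const_mul]
  let L : MvPolynomial ι ℝ →ₗ[ℝ] ℝ := ⟨⟨E, hadd⟩, hsmul⟩
  have hparts (q j) : L (pderiv j q) = 2 * L (X j * q) :=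
    integral_eval_pderiv_mul_exp_neg_norm_sq q j
  change L _ = 2 * (m - 1) * L _
  have hprod (j : ι) : pderiv j (pderiv j p) * X i =
      pderiv j (pderiv j p * X i) - if j = i then pderiv i p else 0 := by
    rcases eq_or_ne j i with rfl | h
    · simp [Derivation.leibniz]
      ring
    · simp [Derivation.leibniz, pderiv_X_of_ne h.symm, h, mul_comm]
  have heuler : ∑ j, X j * (pderiv j p * X i) = (m : ℝ) • (p * X i) := by
    simp_rw [← mul_assoc, ← Finset.sum_mul, hp.sum_X_mul_pderiv]
    simp [← Nat.cast_smul_eq_nsmul ℝ]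
  calc
    L ((∑ j, pderiv j (pderiv j p)) * X i)
      = 2 * L (∑ j, X j * (pderiv j p * X i)) - L (pderiv i p) := by
        simp_rw [Finset.sum_mul, hprod, Finset.sum_sub_distrib, map_sub, map_sum, hparts,
          Finset.mul_sum]
        simp [apply_ite L, hparts]
    _ = 2 * (m - 1) * L (p * X i) := by
        rw [heuler, hparts, map_smul, mul_comm (X i) p, smul_eq_mul]
        ring

theorem stmt10 (N m : ℕ) (hN : 2 ≤ N) (hm : 2 ≤ m) (i : Fin N)
    (p : MvPolynomial (Fin N) ℝ) (hp : p.IsHomogeneous m)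
    (P : EuclideanSpace ℝ (Fin N) → ℝ)
    (hP : ∀ x, P x = MvPolynomial.eval (fun i => x i) p) :
    (∫ x : Metric.sphere (0 : EuclideanSpace ℝ (Fin N)) 1,
        P (x : EuclideanSpace ℝ (Fin N)) * (x : EuclideanSpace ℝ (Fin N)) i ∂(sphereMeasure N))
      = (1 / (2 * ((N : ℝ) + 2) + ((N : ℝ) + m + 1) * ((m : ℝ) - 3))) *
          ∫ x : Metric.sphere (0 : EuclideanSpace ℝ (Fin N)) 1,
            lap P (x : EuclideanSpace ℝ (Fin N)) * (x : EuclideanSpace ℝ (Fin N)) i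
              ∂(sphereMeasure N) := by
  obtain rfl : P = fun x => MvPolynomial.eval (fun k => x k) p := funext hP
  have hN0 : N ≠ 0 := by omega
  have hlap : (∑ j, pderiv j (pderiv j p)).IsHomogeneous (m - 2) :=
    IsHomogeneous.sum _ _ _ fun j _ => hp.pderiv.pderiv
  have key := integral_eval_laplacian_mul_X_mul_exp_neg_norm_sq hp i
  rw [integral_eval_mul_exp_neg_norm_sq hN0 (hlap.mul (isHomogeneous_X ℝ i)),
    integral_eval_mul_exp_neg_norm_sq hN0 (hp.mul (isHomogeneous_X ℝ i))] at key
  simp only [lap_eval]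
  simp only [map_mul, eval_X] at key
  have hm' : (2 : ℝ) ≤ m := by exact_mod_cast hm
  have hN' : (2 : ℝ) ≤ N := by exact_mod_cast hN
  have hpos : (0 : ℝ) < ((m - 2 + 1 : ℕ) + N) / 2 := by positivity
  have hGamma : Real.Gamma (((m + 1 : ℕ) + N) / 2) =
      (m - 1 + N) / 2 * Real.Gamma (((m - 2 + 1 : ℕ) + N) / 2) := by
    have h1 : ((m - 2 + 1 : ℕ) : ℝ) = m - 1 := by
      push_cast [Nat.cast_sub hm]
      ring
    rw [h1, ← Real.Gamma_add_one (by rw [← h1]; exact hpos.ne')]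
    congr 1
    push_cast
    ring
  have hG := (Real.Gamma_pos_of_pos hpos).ne'
  have hden : 2 * ((N : ℝ) + 2) + ((N : ℝ) + m + 1) * ((m : ℝ) - 3) = (m - 1) * (m - 1 + N) := by
    ring
  have hne : ((m : ℝ) - 1) * (m - 1 + N) ≠ 0 := by
    apply mul_ne_zero <;> linarith
  rw [hden, one_div, eq_inv_mul_iff_mul_eq₀ hne]
  rw [hGamma] at key
  refine mul_right_cancel₀ hG ?_
  linear_combination -2 * key
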